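/- In an S2 topology with L spaces and switch set S, let d be an integer with 1 ≤ d ≤ L and let Y = ⟨y_1, …, y_d⟩ ∈ [0,1)^d be an arbitrary target coordinate vector. If a switch s satisfies MCD_d(χ(s), Y) ≤ MCD_d(χ(v), Y) for every graph neighbor v of s (i.e., greedy routing toward Y using the d-MCD cannot make progress at s), then there exists a space r with 1 ≤ r ≤ d such that χ_r(s) attains the minimum of CD(χ_r(w), y_r) over all switches w ∈ S; that is, s is a home switch of Y in space r. -/

import Mathlib

/-- Circular distance on the unit circle `[0,1)` with circumference 1. -/
noncomputable def CD (x y : ℝ) : ℝ := min |x - y| (1 - |x - y|)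

/-- `inArc a b c` : the point `c` lies strictly inside the open circular arc
going from `a` in the positive direction to `b` (coordinates mod 1). -/
def inArc (a b c : ℝ) : Prop :=
  0 < Int.fract (c - a) ∧ Int.fract (c - a) < Int.fract (b - a)

/-- Two points `p ≠ q` of a set `Q` of coordinates are circularly (ring-)adjacent in `Q`
if one of the two open circular arcs between them contains no point of `Q`. -/
def RingAdj (Q : Set ℝ) (p q : ℝ) : Prop :=
  p ∈ Q ∧ q ∈ Q ∧ p ≠ q ∧
    ((∀ r ∈ Q, ¬ inArc p q r) ∨ (∀ r ∈ Q, ¬ inArc q p r))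

/-- `d`-MCD: minimum circular distance over the first `d` spaces, between an
`L`-dimensional coordinate vector `X` and a `d`-dimensional target `Y`. -/
noncomputable def MCDd {L : ℕ} (d : ℕ) (hd : d ≤ L) (X : Fin L → ℝ) (Y : Fin d → ℝ) : ℝ :=
  ⨅ i : Fin d, CD (X (Fin.castLE hd i)) (Y i)

lemma fract_cases (x a : ℝ) (hx : x ∈ Set.Ico (0:ℝ) 1) (ha : a ∈ Set.Ico (0:ℝ) 1) :
    (a ≤ x ∧ Int.fract (x - a) = x - a) ∨ (x < a ∧ Int.fract (x - a) = x - a + 1) := by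
  obtain ⟨hx0, hx1⟩ := hx
  obtain ⟨ha0, ha1⟩ := ha
  rcases le_or_gt a x with h | h
  · left
    exact ⟨h, Int.fract_eq_self.2 ⟨by linarith, by linarith⟩⟩
  · right
    refine ⟨h, ?_⟩
    rw [← Int.fract_add_one]
    exact Int.fract_eq_self.2 ⟨by linarith, by linarith⟩

lemma CD_rot (x y a : ℝ) (hx : x ∈ Set.Ico (0:ℝ) 1) (hy : y ∈ Set.Ico (0:ℝ) 1)
    (ha : a ∈ Set.Ico (0:ℝ) 1) :
    CD x y = CD (Int.fract (x - a)) (Int.fract (y - a)) := by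
  have h1 := fract_cases x a hx ha
  have h2 := fract_cases y a hy ha
  obtain ⟨hx0, hx1⟩ := hx
  obtain ⟨hy0, hy1⟩ := hy
  unfold CD
  rcases h1 with ⟨h1, e1⟩ | ⟨h1, e1⟩ <;> rcases h2 with ⟨h2, e2⟩ | ⟨h2, e2⟩ <;> rw [e1, e2]
  · congr 2 <;> ring_nf
  · rw [abs_of_pos (by linarith : 0 < x - y), abs_of_neg (by linarith), min_comm]
    congr 1 <;> ring
  · rw [abs_of_neg (by linarith : x - y < 0), abs_of_pos (by linarith), min_comm]
    congr 1 <;> ring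
  · congr 2 <;> ring_nf

lemma CD_lt_iff (p t : ℝ) (hp : p ∈ Set.Ico (0:ℝ) 1) (ht : t ∈ Set.Ico (0:ℝ) 1) :
    CD p t < CD 0 t ↔ |p - t| < t ∧ |p - t| < 1 - t := by
  obtain ⟨hp0, hp1⟩ := hp
  obtain ⟨ht0, ht1⟩ := ht
  unfold CD
  rw [zero_sub, abs_neg, abs_of_nonneg ht0, lt_min_iff, min_lt_iff, min_lt_iff]
  rcases abs_cases (p - t) with ⟨h, _⟩ | ⟨h, _⟩ <;> rw [h] <;> constructor
  · rintro ⟨h1 | h1, h2 | h2⟩ <;> constructor <;> linarith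
  · rintro ⟨h1, h2⟩
    exact ⟨Or.inl h1, Or.inl h2⟩
  · rintro ⟨h1 | h1, h2 | h2⟩ <;> constructor <;> linarith
  · rintro ⟨h1, h2⟩
    exact ⟨Or.inl h1, Or.inl h2⟩

lemma exists_closer {S : Type*} [Fintype S] (f : S → ℝ)
    (hf : ∀ s, f s ∈ Set.Ico (0:ℝ) 1) (hinj : Function.Injective f)
    (y : ℝ) (hy : y ∈ Set.Ico (0:ℝ) 1) (s w : S) (hw : CD (f w) y < CD (f s) y) :
    ∃ v, s ≠ v ∧ RingAdj (Set.range f) (f s) (f v) ∧ CD (f v) y < CD (f s) y := by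
  classical
  have hfr : ∀ x : ℝ, Int.fract x ∈ Set.Ico (0:ℝ) 1 :=
    fun x => ⟨Int.fract_nonneg x, Int.fract_lt_one x⟩
  have key : ∀ v, CD (f v) y < CD (f s) y ↔
      |Int.fract (f v - f s) - Int.fract (y - f s)| < Int.fract (y - f s) ∧
      |Int.fract (f v - f s) - Int.fract (y - f s)| < 1 - Int.fract (y - f s) := by
    intro v
    rw [CD_rot (f v) y (f s) (hf v) hy (hf s), CD_rot (f s) y (f s) (hf s) hy (hf s),
      sub_self, Int.fract_zero]
    exact CD_lt_iff _ _ (hfr _) (hfr _)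
  have hsw : w ≠ s := by
    rintro rfl
    exact lt_irrefl _ hw
  have hpos : ∀ v, v ≠ s → 0 < Int.fract (f v - f s) := by
    intro v hv
    have hne : f v ≠ f s := fun h => hv (hinj h)
    obtain ⟨h0, h1⟩ := hf v
    obtain ⟨h2, h3⟩ := hf s
    rcases fract_cases (f v) (f s) (hf v) (hf s) with ⟨h, e⟩ | ⟨h, e⟩ <;> rw [e]
    · have := lt_of_le_of_ne h hne.symm
      linarith
    · linarith
  have hmemw : w ∈ Finset.univ.filter (fun v => v ≠ s) := by simp [hsw]
  rw [key] at hw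
  obtain ⟨hw1, hw2⟩ := hw
  rw [abs_lt] at hw1 hw2
  rcases le_or_gt (Int.fract (y - f s)) (1/2) with ht | ht
  · obtain ⟨v, hv, hmin⟩ := Finset.exists_min_image (Finset.univ.filter (fun v => v ≠ s))
      (fun v => Int.fract (f v - f s)) ⟨w, hmemw⟩
    have hvs : v ≠ s := by simpa using hv
    have hvw := hmin w hmemw
    have hv0 := hpos v hvs
    refine ⟨v, hvs.symm, ⟨⟨s, rfl⟩, ⟨v, rfl⟩, fun h => hvs (hinj h).symm, Or.inl ?_⟩, ?_⟩
    · rintro _ ⟨r, rfl⟩ ⟨h1, h2⟩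
      have hrs : r ≠ s := by
        rintro rfl
        simp at h1
      have := hmin r (by simp [hrs])
      linarith
    · rw [key, abs_lt, abs_lt]
      refine ⟨⟨?_, ?_⟩, ?_, ?_⟩ <;> linarith
  · obtain ⟨v, hv, hmax⟩ := Finset.exists_max_image (Finset.univ.filter (fun v => v ≠ s))
      (fun v => Int.fract (f v - f s)) ⟨w, hmemw⟩
    have hvs : v ≠ s := by simpa using hv
    have hvw := hmax w hmemw
    have hv0 := hpos v hvs
    have hv1 := Int.fract_lt_one (f v - f s)
    refine ⟨v, hvs.symm, ⟨⟨s, rfl⟩, ⟨v, rfl⟩, fun h => hvs (hinj h).symm, Or.inr ?_⟩, ?_⟩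
    · rintro _ ⟨r, rfl⟩ ⟨h1, h2⟩
      have hrs : r ≠ s := by
        rintro rfl
        exact lt_irrefl _ h2
      have h3 := hmax r (by simp [hrs])
      have h4 := hpos r hrs
      rcases fract_cases (f r) (f s) (hf r) (hf s) with ⟨a1, e1⟩ | ⟨a1, e1⟩ <;>
      rcases fract_cases (f v) (f s) (hf v) (hf s) with ⟨a2, e2⟩ | ⟨a2, e2⟩ <;>
      rcases fract_cases (f r) (f v) (hf r) (hf v) with ⟨a3, e3⟩ | ⟨a3, e3⟩ <;>
      rcases fract_cases (f s) (f v) (hf s) (hf v) with ⟨a4, e4⟩ | ⟨a4, e4⟩ <;>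
      linarith
    · rw [key, abs_lt, abs_lt]
      refine ⟨⟨?_, ?_⟩, ?_, ?_⟩ <;> linarith

/-- In an S2 topology with `L` spaces, let `1 ≤ d ≤ L` and let
`Y ∈ [0,1)^d` be an arbitrary target coordinate vector. If greedy routing toward `Y`
using the `d`-MCD cannot make progress at switch `s` (no graph neighbor has a strictly
smaller `d`-MCD to `Y`), then in some space `r ≤ d` the coordinate `χ_r(s)` attains the
minimum circular distance to `y_r` among all switches, i.e. `s` is a home switch of `Y`
in space `r`. -/
theorem stmt_5 {S : Type*} [Fintype S] {L : ℕ}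
    (χ : Fin L → S → ℝ)
    (hmem : ∀ (i : Fin L) (s : S), χ i s ∈ Set.Ico (0 : ℝ) 1)
    (hinj : ∀ i : Fin L, Function.Injective (χ i))
    (G : SimpleGraph S)
    (hG : ∀ (i : Fin L) (u v : S), u ≠ v →
      RingAdj (Set.range (χ i)) (χ i u) (χ i v) → G.Adj u v)
    (d : ℕ) (hd1 : 1 ≤ d) (hd2 : d ≤ L)
    (Y : Fin d → ℝ) (hY : ∀ i : Fin d, Y i ∈ Set.Ico (0 : ℝ) 1)
    (s : S)
    (hstall : ∀ v : S, G.Adj s v →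
      MCDd d hd2 (fun i => χ i s) Y ≤ MCDd d hd2 (fun i => χ i v) Y) :
    ∃ r : Fin d, ∀ w : S,
      CD (χ (Fin.castLE hd2 r) s) (Y r) ≤ CD (χ (Fin.castLE hd2 r) w) (Y r) := by
  have : Nonempty (Fin d) := ⟨⟨0, hd1⟩⟩
  obtain ⟨r, hr⟩ := exists_eq_ciInf_of_finite
    (f := fun i : Fin d => CD (χ (Fin.castLE hd2 i) s) (Y i))
  refine ⟨r, fun w => ?_⟩
  by_contra hlt
  rw [not_le] at hlt
  obtain ⟨v, hsv, hadj, hv⟩ := exists_closer (χ (Fin.castLE hd2 r)) (hmem _) (hinj _) (Y r)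
    (hY r) s w hlt
  have h1 := hstall v (hG _ s v hsv hadj)
  have h2 : MCDd d hd2 (fun i => χ i v) Y ≤ CD (χ (Fin.castLE hd2 r) v) (Y r) :=
    ciInf_le (Set.finite_range (fun i : Fin d => CD (χ (Fin.castLE hd2 i) v) (Y i))).bddBelow r
  have h3 : MCDd d hd2 (fun i => χ i s) Y = CD (χ (Fin.castLE hd2 r) s) (Y r) := hr.symm
  linarith
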